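/- For every 0 < λ < 1/(2‖V‖) (operator norm), there exist a real number Δ(λ) and a constant C > 0 (independent of λ) such that ‖H_eff(H^gad, 2^n) − Δ(λ)·Π_λ − λ³·H^target ⊗ P₊‖ ≤ C·λ⁴, where Π_λ is the orthogonal projector onto the span of eigenvectors of H^gad corresponding to its 2^n lowest eigenvalues (counted with multiplicity). -/

import Mathlib

/-!
STATEMENT 2: The measurement-reduction gadget Hamiltonian mimics
`Δ·Π_λ + λ³·H^target ⊗ P₊` up to an error of order `λ⁴`.
-/

open scoped BigOperators Matrix

noncomputable section

namespace Stmt2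

/-- Pauli X. -/
def PX : Matrix (Fin 2) (Fin 2) ℂ := !![0, 1; 1, 0]
/-- Pauli Y. -/
def PY : Matrix (Fin 2) (Fin 2) ℂ := !![0, -Complex.I; Complex.I, 0]
/-- Pauli Z. -/
def PZ : Matrix (Fin 2) (Fin 2) ℂ := !![1, 0; 0, -1]

/-- One-qubit Pauli operator indexed by `Fin 4`: `0 ↦ I`, `1 ↦ X`, `2 ↦ Y`, `3 ↦ Z`. -/
def pauliOf : Fin 4 → Matrix (Fin 2) (Fin 2) ℂ := ![1, PX, PY, PZ]

variable {ι : Type} [Fintype ι] [DecidableEq ι]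

/-- The operator acting as `A` on qubit `i` and as the identity on all other qubits. -/
def act (i : ι) (A : Matrix (Fin 2) (Fin 2) ℂ) : Matrix (ι → Fin 2) (ι → Fin 2) ℂ :=
  fun f g => if ∀ j, j ≠ i → f j = g j then A (f i) (g i) else 0

/-- The tensor product `⊗_i A i` of one single-qubit operator per qubit. -/
def tensorOn (A : ι → Matrix (Fin 2) (Fin 2) ℂ) : Matrix (ι → Fin 2) (ι → Fin 2) ℂ :=
  fun f g => ∏ i, A i (f i) (g i)

/-- The ℓ²→ℓ² operator norm of a matrix. -/
def opNorm (M : Matrix (ι → Fin 2) (ι → Fin 2) ℂ) : ℝ :=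
  ‖Matrix.toEuclideanCLM (𝕜 := ℂ) M‖

/-- The outer product `v v†`. -/
def outer (v : (ι → Fin 2) → ℂ) : Matrix (ι → Fin 2) (ι → Fin 2) ℂ :=
  Matrix.vecMulVec v (star v)

/-- Index type: `n` target qubits plus `q = 2m` auxiliary qubits, the latter grouped
into `m` pairs (pair `i` consists of the auxiliary qubits `2i−1` and `2i`). -/
abbrev Idx (n m : ℕ) : Type := Fin n ⊕ (Fin m × Fin 2)

/-- Tensor product of a target-register operator with an auxiliary-register operator. -/
def kron (n m : ℕ) (M : Matrix (Fin n → Fin 2) (Fin n → Fin 2) ℂ)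
    (N : Matrix ((Fin m × Fin 2) → Fin 2) ((Fin m × Fin 2) → Fin 2) ℂ) :
    Matrix (Idx n m → Fin 2) (Idx n m → Fin 2) ℂ :=
  fun f g => M (f ∘ Sum.inl) (g ∘ Sum.inl) * N (f ∘ Sum.inr) (g ∘ Sum.inr)

/-- The Pauli-`A` part `H_s^A` of the Pauli string `H_s` described by `ptype s`,
for `A ∈ {1,2,3}` (i.e. `X`, `Y`, `Z`). -/
def Hpart (n r : ℕ) (ptype : Fin r → Fin n → Fin 4) (A : Fin 4) (s : Fin r) :
    Matrix (Fin n → Fin 2) (Fin n → Fin 2) ℂ :=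
  tensorOn (fun i => if ptype s i = A then pauliOf A else 1)

/-- The Pauli string `H_s = H_s^X H_s^Y H_s^Z`. -/
def Hstring (n r : ℕ) (ptype : Fin r → Fin n → Fin 4) (s : Fin r) :
    Matrix (Fin n → Fin 2) (Fin n → Fin 2) ℂ :=
  Hpart n r ptype 1 s * Hpart n r ptype 2 s * Hpart n r ptype 3 s

/-- The target Hamiltonian `H^target = Σ_s c_s H_s`. -/
def Htarget (n r : ℕ) (c : Fin r → ℝ) (ptype : Fin r → Fin n → Fin 4) :
    Matrix (Fin n → Fin 2) (Fin n → Fin 2) ℂ :=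
  ∑ s : Fin r, c s • Hstring n r ptype s

/-- `V_{s,X}^aux = ∏_{i ∈ M_s} τ_{2i}^X`, etc.: Pauli-X on the first qubit of each pair
`i ∈ M_s` for `A = 1` (X), on the second for `A = 2` (Y), and on both for `A = 3` (Z). -/
def Vaux (m r : ℕ) (Msets : Fin r → Finset (Fin m)) (A : Fin 4) (s : Fin r) :
    Matrix ((Fin m × Fin 2) → Fin 2) ((Fin m × Fin 2) → Fin 2) ℂ :=
  tensorOn (fun p =>
    if p.1 ∈ Msets s ∧ (A = 1 ∧ p.2 = 0 ∨ A = 2 ∧ p.2 = 1 ∨ A = 3) then PX else 1)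

/-- The unperturbed Hamiltonian `H^aux = −Σ_{i=1}^q Z_i` on the auxiliary qubits. -/
def Haux (n m : ℕ) : Matrix (Idx n m → Fin 2) (Idx n m → Fin 2) ℂ :=
  -∑ p : Fin m × Fin 2, act (Sum.inr p) PZ

/-- The perturbation `V = Σ_s Σ_{A ∈ {X,Y,Z}} ct_s H_s^A ⊗ V_{s,A}^aux`. -/
def Vpert (n m r : ℕ) (ct : Fin r → ℝ) (ptype : Fin r → Fin n → Fin 4)
    (Msets : Fin r → Finset (Fin m)) :
    Matrix (Idx n m → Fin 2) (Idx n m → Fin 2) ℂ :=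
  ∑ s : Fin r, ∑ A ∈ ({1, 2, 3} : Finset (Fin 4)),
    ct s • kron n m (Hpart n r ptype A s) (Vaux m r Msets A s)

/-- The gadget Hamiltonian `H^gad = H^aux + λ V`. -/
def Hgad (n m r : ℕ) (ct : Fin r → ℝ) (ptype : Fin r → Fin n → Fin 4)
    (Msets : Fin r → Finset (Fin m)) (lam : ℝ) :
    Matrix (Idx n m → Fin 2) (Idx n m → Fin 2) ℂ :=
  Haux n m + lam • Vpert n m r ct ptype Msets

/-- `P₊ = (|0⟩⟨0|)^{⊗q}`, the projector onto the all-zero auxiliary state. -/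
def Pplus (m : ℕ) :
    Matrix ((Fin m × Fin 2) → Fin 2) ((Fin m × Fin 2) → Fin 2) ℂ :=
  fun f g => if (∀ p, f p = 0) ∧ (∀ p, g p = 0) then 1 else 0

theorem exists_approximate_invariance {𝔸 : Type*} [NormedRing 𝔸] [NormedAlgebra ℂ 𝔸]
    (P A R V T : 𝔸) (μ : ℝ) (hAP : A * P = 0) (hAR : A * R = P - 1)
    (hPR : P * R = 0) (h₁ : P * V * P = 0) (h₂ : P * V * R * V * P = (μ : ℂ) • P)
    (h₃ : P * V * R * V * R * V * P = T) :
    ∃ y z : ℝ, 0 ≤ y ∧ 0 ≤ z ∧ ∀ l : ℝ, 0 < l → l ≤ 1 → ∃ Y Z : 𝔸, ‖Y‖ ≤ y ∧ ‖Z‖ ≤ z ∧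
      (A + (l : ℂ) • V - ((l : ℂ) ^ 2 * μ) • 1) * (P + (l : ℂ) • Y) =
        (l : ℂ) ^ 3 • T + (l : ℂ) ^ 4 • Z := by
  set W₁ := R * V * P with hW₁
  set W₂ := R * V * W₁ with hW₂
  set W₃ := R * (V * W₂ - (μ : ℂ) • W₁) with hW₃
  have e₁ : A * W₁ = -(V * P) := by
    rw [hW₁, ← mul_assoc, ← mul_assoc, hAR, sub_mul, sub_mul, h₁, one_mul, zero_sub]
  have e₂ : A * W₂ = (μ : ℂ) • P - V * W₁ := by
    have hPVW₁ : P * (V * W₁) = (μ : ℂ) • P := by rw [← h₂, hW₁]; simp only [mul_assoc]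
    rw [hW₂, mul_assoc, ← mul_assoc, hAR, sub_mul, one_mul, hPVW₁]
  have e₃ : A * W₃ = T - V * W₂ + (μ : ℂ) • W₁ := by
    have hPW₁ : P * W₁ = 0 := by rw [hW₁, ← mul_assoc, ← mul_assoc, hPR]; simp
    have hPVW₂ : P * (V * W₂) = T := by rw [← h₃, hW₂, hW₁]; simp only [mul_assoc]
    rw [hW₃, ← mul_assoc, hAR, sub_mul, one_mul, mul_sub, mul_smul_comm, hPW₁, hPVW₂]
    simp only [smul_zero]; abel
  refine ⟨‖W₁‖ + ‖W₂‖ + ‖W₃‖, ‖V * W₃‖ + ‖(μ : ℂ) • W₂‖ + ‖(μ : ℂ) • W₃‖, by positivity,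
    by positivity, fun l hl hl1 => ⟨W₁ + (l : ℂ) • W₂ + ((l : ℂ) ^ 2) • W₃,
      V * W₃ - (μ : ℂ) • W₂ - (l : ℂ) • (μ : ℂ) • W₃, ?_, ?_, ?_⟩⟩
  · have hn : ‖(l : ℂ)‖ ≤ 1 := by simpa [abs_of_pos hl] using hl1
    refine (norm_add₃_le).trans ?_
    gcongr
    · rw [norm_smul]; exact mul_le_of_le_one_left (norm_nonneg _) hn
    · rw [norm_smul, norm_pow]
      exact mul_le_of_le_one_left (norm_nonneg _) (pow_le_one₀ (norm_nonneg _) hn)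
  · have hn : ‖(l : ℂ)‖ ≤ 1 := by simpa [abs_of_pos hl] using hl1
    refine (norm_sub_le _ _).trans ?_
    gcongr
    · exact norm_sub_le _ _
    · rw [norm_smul]; exact mul_le_of_le_one_left (norm_nonneg _) hn
  · simp only [sub_mul, add_mul, mul_add, smul_mul_assoc, mul_smul_comm, one_mul, hAP, e₁, e₂, e₃]
    module

theorem exists_perturbation_bound {𝔸 : Type*} [NormedRing 𝔸] [NormedAlgebra ℂ 𝔸]
    (P A R V T : 𝔸) (μ : ℝ) (hAP : A * P = 0) (hPP : P * P = P) (hAR : A * R = P - 1)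
    (hRA : R * A = P - 1)
    (hPR : P * R = 0) (h₁ : P * V * P = 0) (h₂ : P * V * R * V * P = (μ : ℂ) • P)
    (h₃ : P * V * R * V * R * V * P = T) :
    ∃ C l₀ : ℝ, 0 < C ∧ 0 < l₀ ∧ ∀ l : ℝ, 0 < l → l ≤ l₀ → ∀ Q Q' B S K : 𝔸,
      K = A + (l : ℂ) • V - ((l : ℂ) ^ 2 * μ) • 1 → Q + Q' = 1 → Q * Q = Q →
      ‖Q‖ ≤ 1 → ‖Q'‖ ≤ 1 → ‖B‖ ≤ 1 → B * K = Q' → S = K * Q → S = Q * K →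
      ‖S‖ ≤ l * ‖V‖ + l ^ 2 * |μ| → ‖P * Q'‖ = ‖Q' * P‖ →
      ‖S - (l : ℂ) ^ 3 • T‖ ≤ C * l ^ 4 := by
  obtain ⟨y, z, hy, hz, H⟩ := exists_approximate_invariance P A R V T μ hAP hAR hPR h₁ h₂ h₃
  have hPT : P * T = T := by rw [← h₃]; simp only [← mul_assoc, hPP]
  have hTP : T * P = T := by rw [← h₃]; simp only [mul_assoc, hPP]
  obtain ⟨c₁, hc₁⟩ : ∃ c, c = ‖T‖ + z + y := ⟨_, rfl⟩
  obtain ⟨c₂, hc₂⟩ : ∃ c, c = ‖R‖ * (2 * (‖V‖ + |μ|)) := ⟨_, rfl⟩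
  obtain ⟨c₃, hc₃⟩ : ∃ c, c = c₁ * ‖T‖ + z := ⟨_, rfl⟩
  have hc₁0 : 0 ≤ c₁ := by rw [hc₁]; positivity
  have hc₂0 : 0 ≤ c₂ := by rw [hc₂]; positivity
  have hc₃0 : 0 ≤ c₃ := by rw [hc₃]; positivity
  refine ⟨‖T‖ * c₁ + c₃ + (y + c₂) * (2 * (‖T‖ + c₃)) + 1, min 1 (1 / (2 * (y + c₂) + 1)),
    by positivity, by positivity, ?_⟩
  intro l hl hl₀ Q Q' B S K hK hQQ' hQQ hQ hQ' hB hBK hSK hSK' hS hPQ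
  have hl1 : l ≤ 1 := hl₀.trans (min_le_left _ _)
  have hlc : l * (y + c₂) ≤ 1 / 2 := by
    have := hl₀.trans (min_le_right _ _)
    rw [le_div_iff₀ (by positivity)] at this
    linarith
  obtain ⟨Y, Z, hY, hZ, hKW⟩ := H l hl hl1
  rw [← hK] at hKW
  have hnl : ‖(l : ℂ)‖ = l := by simp [abs_of_pos hl]
  have mulle : ∀ {a b : 𝔸} {x w : ℝ}, ‖a‖ ≤ x → ‖b‖ ≤ w → ‖a * b‖ ≤ x * w := fun ha hb =>
    (norm_mul_le _ _).trans
      (mul_le_mul ha hb (norm_nonneg _) ((norm_nonneg _).trans ha))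
  have hsm : ∀ (k : ℕ) {a : 𝔸} {x : ℝ}, ‖a‖ ≤ x → ‖(l : ℂ) ^ k • a‖ ≤ l ^ k * x := by
    intro k a x ha
    rw [norm_smul, norm_pow, hnl]; gcongr
  have hQ'P : ‖Q' * P‖ ≤ l * c₁ := by
    have e : Q' * P = (l : ℂ) ^ 3 • (B * T) + (l : ℂ) ^ 4 • (B * Z) - (l : ℂ) ^ 1 • (Q' * Y) := by
      have : Q' * (P + (l : ℂ) • Y) = B * ((l : ℂ) ^ 3 • T + (l : ℂ) ^ 4 • Z) := by
        rw [← hKW, ← mul_assoc, hBK]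
      simp only [mul_add, mul_smul_comm] at this
      rw [pow_one, ← this]; abel
    rw [e]
    have b1 := hsm 3 (mulle hB (le_refl ‖T‖))
    have b2 := hsm 4 (mulle hB hZ)
    have b3 := hsm 1 (mulle hQ' hY)
    have p3 : l ^ 3 ≤ l := by simpa using pow_le_pow_of_le_one hl.le hl1 (show 1 ≤ 3 by norm_num)
    have p4 : l ^ 4 ≤ l := by simpa using pow_le_pow_of_le_one hl.le hl1 (show 1 ≤ 4 by norm_num)
    calc _ ≤ l ^ 3 * (1 * ‖T‖) + l ^ 4 * (1 * z) + l ^ 1 * (1 * y) :=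
          (norm_sub_le _ _).trans (add_le_add ((norm_add_le _ _).trans (add_le_add b1 b2)) b3)
      _ ≤ l * (1 * ‖T‖) + l * (1 * z) + l ^ 1 * (1 * y) := by gcongr
      _ = l * c₁ := by rw [hc₁]; ring
  have hPcQ : ‖(1 - P) * Q‖ ≤ l * c₂ := by
    have e : (1 - P) * Q =
        R * ((l : ℂ) ^ 1 • (V * Q) - (l : ℂ) ^ 2 • ((μ : ℂ) • Q) - S) := by
      have : (1 - P) * Q = -(R * (A * Q)) := by rw [← mul_assoc, hRA]; noncomm_ring
      have hA : A = K - (l : ℂ) • V + ((l : ℂ) ^ 2 * μ) • 1 := by rw [hK]; abel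
      rw [this, hA, hSK, ← mul_neg]
      simp only [sub_mul, add_mul, smul_mul_assoc, one_mul]
      congr 1; module
    rw [e]
    have b1 := hsm 1 (mulle (le_refl ‖V‖) hQ)
    have b2 : ‖(l : ℂ) ^ 2 • ((μ : ℂ) • Q)‖ ≤ l ^ 2 * (|μ| * 1) := hsm 2 (by
      rw [norm_smul, Complex.norm_real, Real.norm_eq_abs]; gcongr)
    have p2 : l ^ 2 ≤ l := by simpa using pow_le_pow_of_le_one hl.le hl1 (show 1 ≤ 2 by norm_num)
    have b3 : l ^ 2 * |μ| ≤ l * |μ| := by gcongr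
    calc _ ≤ ‖R‖ * (l ^ 1 * (‖V‖ * 1) + l ^ 2 * (|μ| * 1) + (l * ‖V‖ + l ^ 2 * |μ|)) :=
          mulle le_rfl ((norm_sub_le _ _).trans
            (add_le_add ((norm_sub_le _ _).trans (add_le_add b1 b2)) hS))
      _ ≤ ‖R‖ * (l * (2 * (‖V‖ + |μ|))) := by gcongr; linarith
      _ = l * c₂ := by rw [hc₂]; ring
  have hQ1 : Q = 1 - Q' := eq_sub_of_add_eq hQQ'
  obtain ⟨Z', hZ', hSW⟩ : ∃ Z' : 𝔸, ‖Z'‖ ≤ c₃ ∧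
      S * (P + (l : ℂ) • Y) = (l : ℂ) ^ 3 • T + (l : ℂ) ^ 4 • Z' := by
    refine ⟨Q * Z - (l : ℂ)⁻¹ • (Q' * P * T), ?_, ?_⟩
    · have b1 := mulle hQ hZ
      have b2 : ‖(l : ℂ)⁻¹ • (Q' * P * T)‖ ≤ c₁ * ‖T‖ := by
        rw [norm_smul, norm_inv, hnl, inv_mul_le_iff₀ hl, ← mul_assoc]
        exact mulle hQ'P le_rfl
      calc _ ≤ 1 * z + c₁ * ‖T‖ := (norm_sub_le _ _).trans (add_le_add b1 b2)
        _ = c₃ := by rw [hc₃]; ring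
    · have hl0 : (l : ℂ) ≠ 0 := by exact_mod_cast hl.ne'
      rw [hSK', mul_assoc, hKW, mul_assoc, hPT, mul_add, mul_smul_comm, mul_smul_comm]
      conv_lhs => rw [hQ1, sub_mul, one_mul]
      rw [smul_sub ((l : ℂ) ^ 4), smul_smul, hQ1,
        show (l : ℂ) ^ 4 * (l : ℂ)⁻¹ = (l : ℂ) ^ 3 by field_simp]
      rw [smul_sub]; abel
  have hSQ : S = ((l : ℂ) ^ 3 • (T * Q) + (l : ℂ) ^ 4 • (Z' * Q)) - (l : ℂ) ^ 1 • (S * Y * Q)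
      + S * ((1 - P) * Q) := by
    have : S = S * (P + (l : ℂ) • Y) * Q - (l : ℂ) • (S * Y * Q) + S * ((1 - P) * Q) := by
      conv_lhs => rw [hSK, ← hQQ, ← mul_assoc, ← hSK]
      simp only [mul_add, add_mul, sub_mul, mul_sub, mul_smul_comm, smul_mul_assoc, one_mul,
        mul_assoc]
      abel
    conv_lhs => rw [this, hSW]
    rw [pow_one, add_mul, smul_mul_assoc, smul_mul_assoc]
  have b2 : ‖(l : ℂ) ^ 4 • (Z' * Q)‖ ≤ l ^ 4 * (c₃ * 1) := hsm 4 (mulle hZ' hQ)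
  have b3 : ‖(l : ℂ) ^ 1 • (S * Y * Q)‖ ≤ l ^ 1 * (‖S‖ * y * 1) :=
    hsm 1 (mulle (mulle le_rfl hY) hQ)
  have b4 : ‖S * ((1 - P) * Q)‖ ≤ ‖S‖ * (l * c₂) := mulle le_rfl hPcQ
  have hSb : ‖S‖ ≤ 2 * l ^ 3 * (‖T‖ + c₃) := by
    have b1 : ‖(l : ℂ) ^ 3 • (T * Q)‖ ≤ l ^ 3 * (‖T‖ * 1) := hsm 3 (mulle le_rfl hQ)
    have : ‖S‖ ≤ l ^ 3 * (‖T‖ * 1) + l ^ 4 * (c₃ * 1) + l ^ 1 * (‖S‖ * y * 1) + ‖S‖ * (l * c₂) := by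
      conv_lhs => rw [hSQ]
      exact (norm_add_le _ _).trans (add_le_add ((norm_sub_le _ _).trans (add_le_add
        ((norm_add_le _ _).trans (add_le_add b1 b2)) b3)) b4)
    have p4 : l ^ 4 * (c₃ * 1) ≤ l ^ 3 * (c₃ * 1) := by
      gcongr ?_ * _
      exact pow_le_pow_of_le_one hl.le hl1 (by norm_num)
    have p5 := mul_le_mul_of_nonneg_left hlc (norm_nonneg S)
    linarith
  have hfin : S - (l : ℂ) ^ 3 • T = (l : ℂ) ^ 4 • (Z' * Q) - (l : ℂ) ^ 1 • (S * Y * Q)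
      + S * ((1 - P) * Q) - (l : ℂ) ^ 3 • (T * (P * Q')) := by
    conv_lhs => rw [hSQ]
    rw [← mul_assoc T P, hTP, hQ1, mul_sub T, mul_one]
    module
  have b1 : ‖(l : ℂ) ^ 3 • (T * (P * Q'))‖ ≤ l ^ 3 * (‖T‖ * (l * c₁)) :=
    hsm 3 (mulle le_rfl (hPQ.trans_le hQ'P))
  rw [hfin]
  have : ‖S‖ * (l * (y + c₂)) ≤ 2 * l ^ 3 * (‖T‖ + c₃) * (l * (y + c₂)) := by gcongr
  calc _ ≤ l ^ 4 * (c₃ * 1) + l ^ 1 * (‖S‖ * y * 1) + ‖S‖ * (l * c₂) + l ^ 3 * (‖T‖ * (l * c₁)) :=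
        (norm_sub_le _ _).trans (add_le_add ((norm_add_le _ _).trans (add_le_add
          ((norm_sub_le _ _).trans (add_le_add b2 b3)) b4)) b1)
    _ ≤ _ := by linarith [pow_pos hl 4]

section Spectral

open scoped Matrix.Norms.L2Operator

open Matrix

variable {X J : Type*} [Fintype X] [DecidableEq X] [Fintype J] [DecidableEq J]

/-- The operator `∑ i, b i |u i⟩⟨u i|`, where the `u i` are the columns of `U`. -/
def eigenSum (U : Matrix X J ℂ) (b : J → ℝ) : Matrix X X ℂ :=
  U * diagonal (fun i => (b i : ℂ)) * Uᴴ

omit [DecidableEq X] in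
theorem eigenSum_mul {U : Matrix X J ℂ} (hU : Uᴴ * U = 1) (b b' : J → ℝ) :
    eigenSum U b * eigenSum U b' = eigenSum U (fun i => b i * b' i) := by
  simp only [eigenSum, Complex.ofReal_mul, ← diagonal_mul_diagonal]
  calc _ = U * diagonal (fun i => (b i : ℂ)) * (Uᴴ * U) * diagonal (fun i => (b' i : ℂ)) * Uᴴ := by
        simp only [Matrix.mul_assoc]
    _ = _ := by rw [hU, Matrix.mul_one]; simp only [Matrix.mul_assoc]

omit [Fintype X] [DecidableEq X] in
theorem eigenSum_add (U : Matrix X J ℂ) (b b' : J → ℝ) :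
    eigenSum U b + eigenSum U b' = eigenSum U (fun i => b i + b' i) := by
  simp only [eigenSum, Complex.ofReal_add, ← diagonal_add, Matrix.mul_add, Matrix.add_mul]

omit [Fintype X] [DecidableEq X] in
theorem conjTranspose_eigenSum (U : Matrix X J ℂ) (b : J → ℝ) :
    (eigenSum U b)ᴴ = eigenSum U b := by
  simp only [eigenSum, conjTranspose_mul, conjTranspose_conjTranspose, diagonal_conjTranspose,
    Matrix.mul_assoc]
  congr 3
  ext i
  simp

theorem norm_eigenSum_le {U : Matrix X J ℂ} (hU : Uᴴ * U = 1) {b : J → ℝ} {c : ℝ} (hc : 0 ≤ c)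
    (hb : ∀ i, |b i| ≤ c) : ‖eigenSum U b‖ ≤ c := by
  have hU1 : ‖U‖ ≤ 1 := by
    have h := l2_opNorm_conjTranspose_mul_self U
    rw [hU, ← diagonal_one, l2_opNorm_diagonal] at h
    have : ‖fun _ : J => (1 : ℂ)‖ ≤ 1 := by
      rw [pi_norm_le_iff_of_nonneg zero_le_one]; simp
    nlinarith
  have hUc : ‖Uᴴ‖ ≤ 1 := (l2_opNorm_conjTranspose U).trans_le hU1
  have hD : ‖diagonal (fun i => (b i : ℂ))‖ ≤ c := by
    rw [l2_opNorm_diagonal, pi_norm_le_iff_of_nonneg hc]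
    simpa using hb
  calc ‖eigenSum U b‖ ≤ ‖U * diagonal (fun i => (b i : ℂ))‖ * ‖Uᴴ‖ := l2_opNorm_mul _ _
    _ ≤ ‖U‖ * ‖diagonal (fun i => (b i : ℂ))‖ * ‖Uᴴ‖ := by gcongr; exact l2_opNorm_mul _ _
    _ ≤ 1 * c * 1 := by gcongr
    _ = c := by ring

omit [DecidableEq X] in
theorem re_star_dotProduct_self (v : X → ℂ) : (star v ⬝ᵥ v).re = ∑ x, ‖v x‖ ^ 2 := by
  simp only [dotProduct, Complex.re_sum]
  refine Finset.sum_congr rfl fun x _ => ?_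
  rw [Pi.star_apply, Complex.star_def, Complex.conj_mul', ← Complex.ofReal_pow, Complex.ofReal_re]

theorem abs_re_star_dotProduct_mulVec_le (V : Matrix X X ℂ) (v : X → ℂ) :
    |(star v ⬝ᵥ V *ᵥ v).re| ≤ ‖V‖ * ∑ x, ‖v x‖ ^ 2 := by
  have hv : ‖WithLp.toLp 2 v‖ ^ 2 = ∑ x, ‖v x‖ ^ 2 := EuclideanSpace.norm_sq_eq _
  have h1 : star v ⬝ᵥ V *ᵥ v = inner ℂ (WithLp.toLp 2 v) (WithLp.toLp 2 (V *ᵥ v)) := by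
    rw [EuclideanSpace.inner_toLp_toLp, dotProduct_comm]
  have h2 : ‖WithLp.toLp 2 (V *ᵥ v)‖ ≤ ‖V‖ * ‖WithLp.toLp 2 v‖ :=
    l2_opNorm_mulVec V (WithLp.toLp 2 v)
  calc |(star v ⬝ᵥ V *ᵥ v).re| ≤ ‖star v ⬝ᵥ V *ᵥ v‖ := Complex.abs_re_le_norm _
    _ ≤ ‖WithLp.toLp 2 v‖ * ‖WithLp.toLp 2 (V *ᵥ v)‖ := by rw [h1]; exact norm_inner_le_norm _ _
    _ ≤ ‖WithLp.toLp 2 v‖ * (‖V‖ * ‖WithLp.toLp 2 v‖) := by gcongr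
    _ = ‖V‖ * ∑ x, ‖v x‖ ^ 2 := by rw [← hv]; ring

omit [DecidableEq X] in
theorem sum_norm_sq_mulVec {U : Matrix X J ℂ} (hU : Uᴴ * U = 1) (x : J → ℂ) :
    ∑ y, ‖(U *ᵥ x) y‖ ^ 2 = ∑ i, ‖x i‖ ^ 2 := by
  rw [← re_star_dotProduct_self, ← re_star_dotProduct_self, star_mulVec, ← dotProduct_mulVec,
    mulVec_mulVec, hU, one_mulVec]

theorem re_star_dotProduct_diagonal_mulVec (a : X → ℝ) (v : X → ℂ) :
    (star v ⬝ᵥ diagonal (fun x => (a x : ℂ)) *ᵥ v).re = ∑ x, a x * ‖v x‖ ^ 2 := by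
  simp only [dotProduct, Complex.re_sum, mulVec_diagonal]
  refine Finset.sum_congr rfl fun x _ => ?_
  rw [Pi.star_apply, Complex.star_def, mul_left_comm, Complex.conj_mul', ← Complex.ofReal_pow,
    ← Complex.ofReal_mul, Complex.ofReal_re]

theorem abs_sum_eigenvalue_sub_le {a : X → ℝ} {V : Matrix X X ℂ} {l : ℝ} (hl : 0 ≤ l)
    {U : Matrix X J ℂ} {E : J → ℝ} (hU : Uᴴ * U = 1)
    (hE : (diagonal (fun x => (a x : ℂ)) + (l : ℂ) • V) * U = U * diagonal (fun i => (E i : ℂ)))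
    (x : J → ℂ) :
    |∑ i, E i * ‖x i‖ ^ 2 - ∑ y, a y * ‖(U *ᵥ x) y‖ ^ 2| ≤ l * ‖V‖ * ∑ i, ‖x i‖ ^ 2 := by
  have key : star (U *ᵥ x) ⬝ᵥ diagonal (fun x => (a x : ℂ)) *ᵥ (U *ᵥ x) +
      (l : ℂ) * (star (U *ᵥ x) ⬝ᵥ V *ᵥ (U *ᵥ x)) =
      star x ⬝ᵥ diagonal (fun i => (E i : ℂ)) *ᵥ x := by
    rw [← smul_eq_mul, ← dotProduct_smul, ← smul_mulVec, ← dotProduct_add, ← add_mulVec,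
      mulVec_mulVec, hE, star_mulVec, ← dotProduct_mulVec, mulVec_mulVec, ← Matrix.mul_assoc, hU,
      Matrix.one_mul]
  have hre := congrArg Complex.re key
  rw [Complex.add_re, re_star_dotProduct_diagonal_mulVec, re_star_dotProduct_diagonal_mulVec,
    Complex.re_ofReal_mul] at hre
  rw [← hre, add_sub_cancel_left, abs_mul, abs_of_nonneg hl, mul_assoc,
    ← sum_norm_sq_mulVec hU x]
  gcongr
  exact abs_re_star_dotProduct_mulVec_le V _

omit [DecidableEq X] in
theorem exists_ne_zero_supported (U : Matrix X J ℂ) (s : Finset J) (t : Finset X)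
    (h : t.card < s.card) :
    ∃ x : J → ℂ, x ≠ 0 ∧ (∀ i ∉ s, x i = 0) ∧ ∀ y ∈ t, (U *ᵥ x) y = 0 := by
  let f : (s → ℂ) →ₗ[ℂ] (t → ℂ) :=
    (U.submatrix (Subtype.val : t → X) (Subtype.val : s → J)).mulVecLin
  have hf : LinearMap.ker f ≠ ⊥ := LinearMap.ker_ne_bot_of_finrank_lt (by simpa using h)
  obtain ⟨z, hz, hz0⟩ := (Submodule.ne_bot_iff _).1 hf
  refine ⟨fun i => if hi : i ∈ s then z ⟨i, hi⟩ else 0, ?_, ?_, ?_⟩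
  · contrapose! hz0
    ext i
    simpa using congrFun hz0 i
  · intro i hi
    simp [hi]
  · intro y hy
    have := congrFun (LinearMap.mem_ker.1 hz) ⟨y, hy⟩
    simp only [f, mulVecLin_apply, mulVec, dotProduct, submatrix_apply, Pi.zero_apply] at this
    refine Eq.trans ?_ this
    rw [mulVec, dotProduct, ← Finset.sum_subset (Finset.subset_univ s)]
    · rw [← Finset.sum_coe_sort s]
      exact Finset.sum_congr rfl fun i _ => by simp
    · intro i _ hi
      simp [hi]

section Gap

variable {N d : ℕ} {a : X → ℝ} {V : Matrix X X ℂ} {l : ℝ} {U : Matrix X (Fin N) ℂ}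
  {E : Fin N → ℝ}

omit [DecidableEq J] in
theorem sum_norm_sq_pos {x : J → ℂ} (hx : x ≠ 0) : 0 < ∑ i, ‖x i‖ ^ 2 := by
  obtain ⟨i, hi⟩ := Function.ne_iff.1 hx
  exact Finset.sum_pos' (fun _ _ => by positivity)
    ⟨i, Finset.mem_univ i, by have : x i ≠ 0 := hi; positivity⟩

theorem neg_le_eigenvalue (ha : ∀ x, a x = 0 ∨ 2 ≤ a x) (hl : 0 ≤ l) (hU : Uᴴ * U = 1)
    (hE : (diagonal (fun x => (a x : ℂ)) + (l : ℂ) • V) * U = U * diagonal (fun i => (E i : ℂ)))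
    (j : Fin N) : -(l * ‖V‖) ≤ E j := by
  have h := abs_sum_eigenvalue_sub_le hl hU hE (Pi.single j 1)
  have e : ∀ i, ‖(Pi.single j 1 : Fin N → ℂ) i‖ ^ 2 = if i = j then 1 else 0 := by
    intro i
    by_cases hi : i = j
    · subst hi; simp
    · simp [hi]
  simp only [e, mul_ite, mul_one, mul_zero, Finset.sum_ite_eq', Finset.mem_univ, if_true] at h
  have : 0 ≤ ∑ y, a y * ‖(U *ᵥ Pi.single j 1) y‖ ^ 2 := Finset.sum_nonneg fun y _ => by
    have : 0 ≤ a y := by rcases ha y with h | h <;> linarith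
    positivity
  linarith [(abs_le.1 h).1]

theorem le_eigenvalue_of_le (hd : (Finset.univ.filter fun x => a x = 0).card = d)
    (ha : ∀ x, a x = 0 ∨ 2 ≤ a x) (hl : 0 ≤ l) (hU : Uᴴ * U = 1)
    (hE : (diagonal (fun x => (a x : ℂ)) + (l : ℂ) • V) * U = U * diagonal (fun i => (E i : ℂ)))
    (hmono : Monotone E) {j : Fin N} (hj : d ≤ j) : 2 - l * ‖V‖ ≤ E j := by
  obtain ⟨x, hx0, hxs, hxt⟩ := exists_ne_zero_supported U (Finset.Iic j)
    (Finset.univ.filter fun x => a x = 0) (by rw [hd, Fin.card_Iic]; omega)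
  have h := abs_sum_eigenvalue_sub_le hl hU hE x
  have h1 : ∑ i, E i * ‖x i‖ ^ 2 ≤ E j * ∑ i, ‖x i‖ ^ 2 := by
    rw [Finset.mul_sum]
    refine Finset.sum_le_sum fun i _ => ?_
    by_cases hi : i ≤ j
    · gcongr; exact hmono hi
    · simp [hxs i (by simpa using hi)]
  have h2 : 2 * ∑ i, ‖x i‖ ^ 2 ≤ ∑ y, a y * ‖(U *ᵥ x) y‖ ^ 2 := by
    rw [← sum_norm_sq_mulVec hU, Finset.mul_sum]
    refine Finset.sum_le_sum fun y _ => ?_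
    rcases ha y with hy | hy
    · simp [hxt y (by simpa using hy)]
    · gcongr
  have h3 := sum_norm_sq_pos hx0
  refine le_of_mul_le_mul_right ?_ h3
  linarith [(abs_le.1 h).1]

theorem eigenvalue_le_of_lt (hN : Fintype.card X = N)
    (hd : (Finset.univ.filter fun x => a x = 0).card = d) (hl : 0 ≤ l) (hU : Uᴴ * U = 1)
    (hE : (diagonal (fun x => (a x : ℂ)) + (l : ℂ) • V) * U = U * diagonal (fun i => (E i : ℂ)))
    (hmono : Monotone E) {j : Fin N} (hj : j < d) : E j ≤ l * ‖V‖ := by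
  have hc := Finset.card_filter_add_card_filter_not (s := Finset.univ) (fun x => a x = 0)
  rw [hd, Finset.card_univ, hN] at hc
  obtain ⟨x, hx0, hxs, hxt⟩ := exists_ne_zero_supported U (Finset.Ici j)
    (Finset.univ.filter fun x => ¬ a x = 0) (by rw [Fin.card_Ici]; omega)
  have h := abs_sum_eigenvalue_sub_le hl hU hE x
  have h1 : E j * ∑ i, ‖x i‖ ^ 2 ≤ ∑ i, E i * ‖x i‖ ^ 2 := by
    rw [Finset.mul_sum]
    refine Finset.sum_le_sum fun i _ => ?_
    by_cases hi : j ≤ i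
    · gcongr; exact hmono hi
    · simp [hxs i (by simpa using hi)]
  have h2 : ∑ y, a y * ‖(U *ᵥ x) y‖ ^ 2 = 0 := by
    refine Finset.sum_eq_zero fun y _ => ?_
    by_cases hy : a y = 0
    · simp [hy]
    · simp [hxt y (by simpa using hy)]
  have h3 := sum_norm_sq_pos hx0
  refine le_of_mul_le_mul_right ?_ h3
  linarith [(abs_le.1 h).2]

end Gap

theorem exists_effective_hamiltonian_bound {N d : ℕ} {a : X → ℝ} {V P R T : Matrix X X ℂ} {μ : ℝ}
    (ha : ∀ x, a x = 0 ∨ 2 ≤ a x) (hN : Fintype.card X = N)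
    (hd : (Finset.univ.filter fun x => a x = 0).card = d)
    (hP : P = diagonal fun x => if a x = 0 then 1 else 0)
    (hR : R = diagonal fun x => -(a x : ℂ)⁻¹)
    (h₁ : P * V * P = 0) (h₂ : P * V * R * V * P = (μ : ℂ) • P)
    (h₃ : P * V * R * V * R * V * P = T) :
    ∃ C : ℝ, 0 < C ∧ ∀ l : ℝ, 0 < l → ∀ (E : Fin N → ℝ) (U : Matrix X (Fin N) ℂ),
      Monotone E → Uᴴ * U = 1 →
      (diagonal (fun x => (a x : ℂ)) + (l : ℂ) • V) * U = U * diagonal (fun i => (E i : ℂ)) →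
      ‖eigenSum U (fun i => if (i : ℕ) < d then E i - l ^ 2 * μ else 0) - (l : ℂ) ^ 3 • T‖ ≤
        C * l ^ 4 := by
  obtain ⟨C, l₀, hC, hl₀, H⟩ := exists_perturbation_bound P (diagonal fun x => (a x : ℂ)) R V T μ
    (by rw [hP, diagonal_mul_diagonal, ← diagonal_zero]; congr 1; ext x
        split_ifs with h <;> simp [h])
    (by rw [hP, diagonal_mul_diagonal]; congr 1; ext x; split_ifs <;> simp)
    (by
      rw [hP, hR, diagonal_mul_diagonal, ← diagonal_one, diagonal_sub]; congr 1; ext x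
      split_ifs with h <;> simp [h])
    (by
      rw [hP, hR, diagonal_mul_diagonal, ← diagonal_one, diagonal_sub]; congr 1; ext x
      split_ifs with h <;> simp [h])
    (by rw [hP, hR, diagonal_mul_diagonal, ← diagonal_zero]; congr 1; ext x
        split_ifs with h <;> simp [h])
    h₁ h₂ h₃
  obtain ⟨l₁, hl₁, hl₁0, hl₁1, hl₁V⟩ :
      ∃ l₁ : ℝ, 0 < l₁ ∧ l₁ ≤ l₀ ∧ l₁ ≤ 1 ∧ l₁ * (‖V‖ + |μ|) ≤ 1 := by
    refine ⟨min (min l₀ 1) (1 / (‖V‖ + |μ| + 1)), by positivity,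
      (min_le_left _ _).trans (min_le_left _ _), (min_le_left _ _).trans (min_le_right _ _), ?_⟩
    calc _ ≤ 1 / (‖V‖ + |μ| + 1) * (‖V‖ + |μ| + 1) :=
          mul_le_mul (min_le_right _ _) (by linarith) (by positivity) (by positivity)
      _ = 1 := by field_simp
  refine ⟨C + (‖V‖ / l₁ ^ 3 + |μ| / l₁ ^ 2 + ‖T‖ / l₁), by positivity, ?_⟩
  intro l hl E U hmono hU hE
  have hUU : U * Uᴴ = 1 := (mul_eq_one_comm_of_card_eq _ _ _ (by simp [hN])).1 hU
  set e : Fin N → ℝ := fun i => E i - l ^ 2 * μ with he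
  have hSn : ‖eigenSum U (fun i => if (i : ℕ) < d then e i else 0)‖ ≤ l * ‖V‖ + l ^ 2 * |μ| := by
    refine norm_eigenSum_le hU (by positivity) fun i => ?_
    split_ifs with hi
    · refine (abs_sub _ _).trans (add_le_add ?_ ?_)
      · exact abs_le.2 ⟨neg_le_eigenvalue ha hl.le hU hE i,
          eigenvalue_le_of_lt hN hd hl.le hU hE hmono hi⟩
      · rw [abs_mul, abs_of_nonneg (sq_nonneg l)]
    · rw [abs_zero]; positivity
  rcases le_or_gt l l₁ with hll | hll
  · have hgap : ∀ i : Fin N, d ≤ i → 1 ≤ e i := fun i hi => by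
      have h1 := le_eigenvalue_of_le hd ha hl.le hU hE hmono hi
      have h2 : l * (‖V‖ + |μ|) ≤ 1 := le_trans (by gcongr) hl₁V
      have h3 : l ^ 2 * μ ≤ l * |μ| := by
        have : l ^ 2 ≤ l := by nlinarith
        calc l ^ 2 * μ ≤ l ^ 2 * |μ| := by gcongr; exact le_abs_self μ
          _ ≤ _ := by gcongr
      simp only [he]
      linarith
    have hK : eigenSum U e =
        diagonal (fun x => (a x : ℂ)) + (l : ℂ) • V - ((l : ℂ) ^ 2 * μ) • 1 := by
      have h1 : eigenSum U E = diagonal (fun x => (a x : ℂ)) + (l : ℂ) • V := by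
        rw [eigenSum, ← hE, Matrix.mul_assoc, hUU, Matrix.mul_one]
      have h2 : ((l : ℂ) ^ 2 * μ) • (1 : Matrix X X ℂ) = eigenSum U (fun _ => l ^ 2 * μ) := by
        have : diagonal (fun _ : Fin N => ((l ^ 2 * μ : ℝ) : ℂ)) =
            ((l : ℂ) ^ 2 * μ) • (1 : Matrix (Fin N) (Fin N) ℂ) := by
          rw [smul_one_eq_diagonal]; push_cast; rfl
        rw [eigenSum, this, Matrix.mul_smul, Matrix.smul_mul, Matrix.mul_one, hUU]
      rw [← h1, h2, eq_sub_iff_add_eq, eigenSum_add]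
      simp [he]
    have hb := H l hl (hll.trans hl₁0) (eigenSum U fun i => if (i : ℕ) < d then 1 else 0)
      (eigenSum U fun i => if (i : ℕ) < d then 0 else 1)
      (eigenSum U fun i => if (i : ℕ) < d then 0 else (e i)⁻¹)
      (eigenSum U (fun i => if (i : ℕ) < d then e i else 0)) (eigenSum U e) hK
      (by
        rw [eigenSum_add]
        have : (fun i : Fin N => (if (i : ℕ) < d then (1 : ℝ) else 0) +
            if (i : ℕ) < d then 0 else 1)
            = fun _ => 1 := by ext i; split_ifs <;> simp
        rw [this, eigenSum]; simp [hUU])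
      (by rw [eigenSum_mul hU]; congr 1; ext i; split_ifs <;> simp)
      (norm_eigenSum_le hU zero_le_one fun i => by split_ifs <;> simp)
      (norm_eigenSum_le hU zero_le_one fun i => by split_ifs <;> simp)
      (norm_eigenSum_le hU zero_le_one fun i => by
        split_ifs with hi
        · simp
        · have := hgap i (not_lt.1 hi)
          rw [abs_inv, abs_of_pos (by linarith)]
          exact inv_le_one_of_one_le₀ this)
      (by
        rw [eigenSum_mul hU]
        congr 1; ext i
        split_ifs with hi
        · simp
        · have := hgap i (not_lt.1 hi)
          exact inv_mul_cancel₀ (by linarith))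
      (by rw [eigenSum_mul hU]; simp)
      (by rw [eigenSum_mul hU]; simp)
      hSn
      (by
        rw [← l2_opNorm_conjTranspose, conjTranspose_mul, conjTranspose_eigenSum, hP,
          diagonal_conjTranspose]
        congr 3; ext x; simp [apply_ite])
    refine hb.trans ?_
    have : 0 ≤ ‖V‖ / l₁ ^ 3 + |μ| / l₁ ^ 2 + ‖T‖ / l₁ := by positivity
    gcongr
    linarith
  · have hT : ‖(l : ℂ) ^ 3 • T‖ ≤ l ^ 3 * ‖T‖ := by
      rw [norm_smul, norm_pow, Complex.norm_real, Real.norm_eq_abs, abs_of_pos hl]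
    have b1 : l * ‖V‖ ≤ ‖V‖ / l₁ ^ 3 * l ^ 4 := by
      rw [div_mul_eq_mul_div, le_div_iff₀ (by positivity)]
      calc l * ‖V‖ * l₁ ^ 3 ≤ l * ‖V‖ * l ^ 3 := by gcongr
        _ = _ := by ring
    have b2 : l ^ 2 * |μ| ≤ |μ| / l₁ ^ 2 * l ^ 4 := by
      rw [div_mul_eq_mul_div, le_div_iff₀ (by positivity)]
      calc l ^ 2 * |μ| * l₁ ^ 2 ≤ l ^ 2 * |μ| * l ^ 2 := by gcongr
        _ = _ := by ring
    have b3 : l ^ 3 * ‖T‖ ≤ ‖T‖ / l₁ * l ^ 4 := by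
      rw [div_mul_eq_mul_div, le_div_iff₀ (by positivity)]
      calc l ^ 3 * ‖T‖ * l₁ ≤ l ^ 3 * ‖T‖ * l := by gcongr
        _ = _ := by ring
    have b4 : 0 ≤ C * l ^ 4 := by positivity
    calc _ ≤ (l * ‖V‖ + l ^ 2 * |μ|) + l ^ 3 * ‖T‖ :=
          (norm_sub_le _ _).trans (add_le_add hSn hT)
      _ ≤ _ := by linarith

end Spectral

section Register

open Matrix

theorem kron_mul (n m : ℕ) (M M' : Matrix (Fin n → Fin 2) (Fin n → Fin 2) ℂ)
    (N N' : Matrix ((Fin m × Fin 2) → Fin 2) ((Fin m × Fin 2) → Fin 2) ℂ) :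
    kron n m M N * kron n m M' N' = kron n m (M * M') (N * N') := by
  ext f g
  simp only [kron, mul_apply, Finset.sum_mul_sum]
  rw [← Fintype.sum_prod_type', ← (Equiv.sumArrowEquivProdArrow _ _ _).sum_comp]
  refine Finset.sum_congr rfl fun h _ => ?_
  simp only [Equiv.sumArrowEquivProdArrow, Equiv.coe_fn_mk]
  ring

theorem kron_sum_left {κ : Type*} (n m : ℕ) (s : Finset κ)
    (M : κ → Matrix (Fin n → Fin 2) (Fin n → Fin 2) ℂ)
    (N : Matrix ((Fin m × Fin 2) → Fin 2) ((Fin m × Fin 2) → Fin 2) ℂ) :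
    kron n m (∑ k ∈ s, M k) N = ∑ k ∈ s, kron n m (M k) N := by
  ext f g
  simp only [kron, Matrix.sum_apply, Finset.sum_mul]

theorem kron_smul_left (n m : ℕ) (c : ℂ) (M : Matrix (Fin n → Fin 2) (Fin n → Fin 2) ℂ)
    (N : Matrix ((Fin m × Fin 2) → Fin 2) ((Fin m × Fin 2) → Fin 2) ℂ) :
    kron n m (c • M) N = c • kron n m M N := by
  ext f g
  simp only [kron, Matrix.smul_apply, smul_eq_mul, mul_assoc]

theorem kron_smul_right (n m : ℕ) (c : ℂ) (M : Matrix (Fin n → Fin 2) (Fin n → Fin 2) ℂ)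
    (N : Matrix ((Fin m × Fin 2) → Fin 2) ((Fin m × Fin 2) → Fin 2) ℂ) :
    kron n m M (c • N) = c • kron n m M N := by
  ext f g
  simp only [kron, Matrix.smul_apply, smul_eq_mul]
  ring

theorem kron_zero_right (n m : ℕ) (M : Matrix (Fin n → Fin 2) (Fin n → Fin 2) ℂ) :
    kron n m M 0 = 0 := by
  ext f g
  simp only [kron, Matrix.zero_apply, mul_zero]

theorem kron_one_diagonal (n m : ℕ) (w : ((Fin m × Fin 2) → Fin 2) → ℂ) :
    kron n m 1 (diagonal w) = diagonal fun f => w (f ∘ Sum.inr) := by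
  ext f g
  by_cases h : f = g
  · subst h; simp [kron]
  · rw [diagonal_apply_ne _ h, kron]
    by_cases h1 : f ∘ Sum.inl = g ∘ Sum.inl
    · rw [diagonal_apply_ne _ fun h2 => h ?_, mul_zero]
      ext (i | i)
      · rw [show f (Sum.inl i) = g (Sum.inl i) from congrFun h1 i]
      · rw [show f (Sum.inr i) = g (Sum.inr i) from congrFun h2 i]
    · rw [one_apply_ne h1, zero_mul]

/-- The product of Pauli-X operators over the qubits `i` with `φ i = 1`. -/
def flipOp (φ : ι → Fin 2) : Matrix (ι → Fin 2) (ι → Fin 2) ℂ :=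
  fun f g => if f = φ + g then 1 else 0

theorem flipOp_mul (φ φ' : ι → Fin 2) : flipOp φ * flipOp φ' = flipOp (φ + φ') := by
  ext f g
  simp only [flipOp, mul_apply, mul_ite, mul_one, mul_zero, Finset.sum_ite_eq', Finset.mem_univ,
    if_true, add_assoc]

omit [DecidableEq ι] in
theorem tensorOn_ite_PX (p : ι → Prop) [DecidablePred p] :
    tensorOn (fun i => if p i then PX else 1) = flipOp fun i => if p i then 1 else 0 := by
  ext f g
  have h : ∀ i, (if p i then PX else 1) (f i) (g i) =
      if f i = (if p i then 1 else 0) + g i then 1 else 0 := by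
    intro i
    generalize f i = x
    generalize g i = y
    split_ifs <;> fin_cases x <;> fin_cases y <;> simp_all [PX]
  simp only [tensorOn, flipOp, h, Finset.prod_boole, funext_iff, Pi.add_apply, Finset.mem_univ,
    true_imp_iff]

theorem Pplus_eq_diagonal (m : ℕ) : Pplus m = diagonal fun f => if f = 0 then 1 else 0 := by
  ext f g
  have h0 : ∀ h : Fin m × Fin 2 → Fin 2, (∀ p, h p = 0) ↔ h = 0 := fun h => funext_iff.symm
  simp only [Pplus, diagonal_apply, h0]
  by_cases h : f = 0
  · simp [h, eq_comm]
  · simp [h]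

theorem Pplus_mul_flipOp_mul_Pplus (m : ℕ) (φ : Fin m × Fin 2 → Fin 2) :
    Pplus m * flipOp φ * Pplus m = if φ = 0 then Pplus m else 0 := by
  rw [Pplus_eq_diagonal]
  ext f g
  rw [mul_diagonal, diagonal_mul]
  by_cases hf : f = 0
  · by_cases hg : g = 0
    · subst hf hg
      by_cases hφ : φ = 0
      · simp [flipOp, hφ]
      · simp [flipOp, hφ, Ne.symm hφ]
    · by_cases hφ : φ = 0
      · simp [hg, hf, hφ, Ne.symm hg]
      · simp [hg, hφ]
  · by_cases hφ : φ = 0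
    · simp [hf, hφ, diagonal_apply]
    · simp [hf, hφ]

theorem Pplus_mul_flipOp_mul_diagonal (m : ℕ) (φ : Fin m × Fin 2 → Fin 2)
    (w : (Fin m × Fin 2 → Fin 2) → ℂ) :
    Pplus m * flipOp φ * diagonal w = w φ • (Pplus m * flipOp φ) := by
  rw [Pplus_eq_diagonal]
  ext f g
  rw [mul_diagonal, diagonal_mul, Matrix.smul_apply, diagonal_mul, smul_eq_mul]
  by_cases hf : f = 0
  · by_cases h : φ = g
    · subst h; ring
    · have : ¬ (0 = φ + g) := fun H => h <| by
        ext i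
        have := congrFun H i
        revert this
        simp only [Pi.add_apply, Pi.zero_apply]
        generalize φ i = x
        generalize g i = y
        revert x y
        decide
      simp [flipOp, hf, this]
  · simp [hf]

theorem diagonal_mul_flipOp_mul_Pplus (m : ℕ) (φ : Fin m × Fin 2 → Fin 2)
    (w : (Fin m × Fin 2 → Fin 2) → ℂ) :
    diagonal w * (flipOp φ * Pplus m) = w φ • (flipOp φ * Pplus m) := by
  rw [Pplus_eq_diagonal]
  ext f g
  rw [diagonal_mul, mul_diagonal, Matrix.smul_apply, mul_diagonal, smul_eq_mul]
  by_cases hg : g = 0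
  · by_cases h : f = φ
    · subst h; ring
    · simp [flipOp, hg, h]
  · simp [hg]

variable {κ : Type*} {n m : ℕ}

section Expansion

variable (K : Finset κ) (c : κ → ℂ) (H : κ → Matrix (Fin n → Fin 2) (Fin n → Fin 2) ℂ)
  (φ : κ → Fin m × Fin 2 → Fin 2) (w : (Fin m × Fin 2 → Fin 2) → ℂ)

theorem first_order_expansion :
    kron n m 1 (Pplus m) * (∑ k ∈ K, c k • kron n m (H k) (flipOp (φ k))) * kron n m 1 (Pplus m) =
      kron n m (∑ k ∈ K, (if φ k = 0 then c k else 0) • H k) (Pplus m) := by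
  rw [kron_sum_left, Finset.mul_sum, Finset.sum_mul]
  refine Finset.sum_congr rfl fun k _ => ?_
  rw [Matrix.mul_smul, Matrix.smul_mul, kron_mul, kron_mul, Matrix.one_mul, Matrix.mul_one,
    Pplus_mul_flipOp_mul_Pplus]
  split_ifs
  · rw [kron_smul_left]
  · rw [kron_zero_right, kron_smul_left, smul_zero, zero_smul]

theorem second_order_expansion :
    kron n m 1 (Pplus m) * (∑ k ∈ K, c k • kron n m (H k) (flipOp (φ k))) *
        kron n m 1 (diagonal w) * (∑ k ∈ K, c k • kron n m (H k) (flipOp (φ k))) *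
        kron n m 1 (Pplus m) =
      kron n m (∑ k ∈ K, ∑ k' ∈ K,
        (if φ k + φ k' = 0 then c k * c k' * w (φ k) else 0) • (H k * H k')) (Pplus m) := by
  simp only [kron_sum_left, Finset.mul_sum, Finset.sum_mul]
  rw [Finset.sum_comm]
  refine Finset.sum_congr rfl fun k _ => Finset.sum_congr rfl fun k' _ => ?_
  simp only [Matrix.mul_smul, Matrix.smul_mul, kron_mul, Matrix.one_mul, Matrix.mul_one]
  rw [Pplus_mul_flipOp_mul_diagonal, Matrix.smul_mul, Matrix.smul_mul, Matrix.mul_assoc (Pplus m),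
    flipOp_mul, Pplus_mul_flipOp_mul_Pplus, kron_smul_left]
  split_ifs
  · rw [kron_smul_right]; module
  · simp only [smul_zero, kron_zero_right, zero_smul]

theorem third_order_expansion :
    kron n m 1 (Pplus m) * (∑ k ∈ K, c k • kron n m (H k) (flipOp (φ k))) *
        kron n m 1 (diagonal w) * (∑ k ∈ K, c k • kron n m (H k) (flipOp (φ k))) *
        kron n m 1 (diagonal w) * (∑ k ∈ K, c k • kron n m (H k) (flipOp (φ k))) *
        kron n m 1 (Pplus m) =
      kron n m (∑ k ∈ K, ∑ k' ∈ K, ∑ k'' ∈ K,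
        (if φ k + φ k' + φ k'' = 0 then c k * c k' * c k'' * w (φ k) * w (φ k'') else 0) •
          (H k * H k' * H k'')) (Pplus m) := by
  simp only [kron_sum_left, Finset.mul_sum, Finset.sum_mul]
  rw [Finset.sum_comm]
  refine (Finset.sum_congr rfl fun _ _ => Finset.sum_comm).trans ?_
  rw [Finset.sum_comm]
  refine Finset.sum_congr rfl fun k _ => ?_
  refine Finset.sum_congr rfl fun k' _ => Finset.sum_congr rfl fun k'' _ => ?_
  simp only [Matrix.mul_smul, Matrix.smul_mul, kron_mul, Matrix.one_mul, Matrix.mul_one]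
  rw [Pplus_mul_flipOp_mul_diagonal]
  simp only [Matrix.smul_mul]
  rw [Matrix.mul_assoc _ (flipOp (φ k'')), Matrix.mul_assoc _ (diagonal w),
    diagonal_mul_flipOp_mul_Pplus, Matrix.mul_smul, ← Matrix.mul_assoc, Matrix.mul_assoc (Pplus m),
    flipOp_mul, Matrix.mul_assoc (Pplus m), flipOp_mul, Pplus_mul_flipOp_mul_Pplus, kron_smul_left]
  split_ifs
  · rw [kron_smul_right, kron_smul_right]; module
  · simp only [smul_zero, kron_zero_right, zero_smul]

end Expansion

end Register

section PauliStrings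

open Matrix

theorem tensorOn_mul (A B : ι → Matrix (Fin 2) (Fin 2) ℂ) :
    tensorOn A * tensorOn B = tensorOn fun i => A i * B i := by
  ext f g
  simp only [tensorOn, mul_apply, ← Finset.prod_mul_distrib]
  rw [Finset.prod_univ_sum, Fintype.piFinset_univ]

omit [DecidableEq ι] in
theorem tensorOn_one : tensorOn (fun _ : ι => 1) = 1 := by
  ext f g
  simp only [tensorOn, one_apply, Finset.prod_boole, funext_iff, Finset.mem_univ, true_imp_iff]

theorem pauliOf_mul_self (A : Fin 4) : pauliOf A * pauliOf A = 1 := by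
  fin_cases A <;> ext i j <;> fin_cases i <;> fin_cases j <;>
    simp [pauliOf, PX, PY, PZ, mul_apply, Fin.sum_univ_two]

variable {n r : ℕ} (ptype : Fin r → Fin n → Fin 4)

theorem Hpart_mul_self (A : Fin 4) (s : Fin r) :
    Hpart n r ptype A s * Hpart n r ptype A s = 1 := by
  rw [Hpart, tensorOn_mul, ← tensorOn_one]
  congr 1
  ext1 i
  split_ifs
  · exact pauliOf_mul_self A
  · exact Matrix.one_mul 1

theorem Hpart_comm (A B : Fin 4) (s : Fin r) :
    Hpart n r ptype A s * Hpart n r ptype B s = Hpart n r ptype B s * Hpart n r ptype A s := by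
  rw [Hpart, Hpart, tensorOn_mul, tensorOn_mul]
  congr 1
  ext1 i
  split_ifs with hA hB
  · rw [← hA, ← hB]
  all_goals simp

end PauliStrings

section FlipVectors

variable {m : ℕ}

/-- Whether the auxiliary operator of type `A` flips the qubit in position `b` of a pair. -/
def flipBit (A : Fin 4) (b : Fin 2) : Fin 2 :=
  if A = 1 ∧ b = 0 ∨ A = 2 ∧ b = 1 ∨ A = 3 then 1 else 0

/-- The set of auxiliary qubits flipped by the operator of type `A` on the pairs in `M`. -/
def flipVec (M : Finset (Fin m)) (A : Fin 4) (p : Fin m × Fin 2) : Fin 2 :=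
  if p.1 ∈ M then flipBit A p.2 else 0

theorem Vaux_eq_flipOp (r : ℕ) (Msets : Fin r → Finset (Fin m)) (A : Fin 4) (s : Fin r) :
    Vaux m r Msets A s = flipOp (flipVec (Msets s) A) := by
  rw [Vaux, tensorOn_ite_PX]
  congr 1
  ext1 p
  rw [flipVec, flipBit, ite_and]

theorem sum_flipVec {M : Finset (Fin m)} (hM : Odd M.card) (A : Fin 4) (b : Fin 2) :
    ∑ i, flipVec M A (i, b) = flipBit A b := by
  obtain ⟨k, hk⟩ := hM
  have h2 : ∀ x : Fin 2, 2 • x = 0 := by decide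
  simp only [flipVec, Finset.sum_ite_mem, Finset.univ_inter, Finset.sum_const, hk]
  rw [add_nsmul, mul_nsmul, h2, nsmul_zero, zero_add, one_nsmul]

theorem flipBit_pair {A A' : Fin 4} (hA : A ∈ ({1, 2, 3} : Finset (Fin 4)))
    (hA' : A' ∈ ({1, 2, 3} : Finset (Fin 4))) (h : ∀ b, flipBit A b + flipBit A' b = 0) :
    A = A' := by
  revert A A'
  decide

theorem flipBit_triple {A A' A'' : Fin 4} (hA : A ∈ ({1, 2, 3} : Finset (Fin 4)))
    (hA' : A' ∈ ({1, 2, 3} : Finset (Fin 4))) (hA'' : A'' ∈ ({1, 2, 3} : Finset (Fin 4)))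
    (h : ∀ b, flipBit A b + flipBit A' b + flipBit A'' b = 0) :
    A ≠ A' ∧ A' ≠ A'' ∧ A ≠ A'' := by
  revert A A' A''
  decide

theorem ite_flipBit_pair {A : Fin 4} (hA : A ∈ ({1, 2, 3} : Finset (Fin 4))) (x x' : Bool) :
    (∀ b, (if x then flipBit A b else 0) + (if x' then flipBit A b else 0) = 0) ↔ x = x' := by
  revert A x x'
  decide

theorem ite_flipBit_triple {A A' A'' : Fin 4} (hA : A ∈ ({1, 2, 3} : Finset (Fin 4)))
    (hA' : A' ∈ ({1, 2, 3} : Finset (Fin 4))) (hA'' : A'' ∈ ({1, 2, 3} : Finset (Fin 4)))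
    (h : A ≠ A' ∧ A' ≠ A'' ∧ A ≠ A'') (x x' x'' : Bool) :
    (∀ b, (if x then flipBit A b else 0) + (if x' then flipBit A' b else 0) +
      (if x'' then flipBit A'' b else 0) = 0) ↔ x = x' ∧ x' = x'' := by
  revert A A' A'' x x' x''
  decide

theorem flipVec_ne_zero {M : Finset (Fin m)} (hM : Odd M.card) {A : Fin 4}
    (hA : A ∈ ({1, 2, 3} : Finset (Fin 4))) : flipVec M A ≠ 0 := by
  intro h
  have hb : ∀ b, flipBit A b = 0 := fun b => by rw [← sum_flipVec hM A b, h]; simp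
  have : ∀ A ∈ ({1, 2, 3} : Finset (Fin 4)), ¬ ∀ b, flipBit A b = 0 := by decide
  exact this A hA hb

theorem flipVec_add_eq_zero_iff {M M' : Finset (Fin m)} (hM : Odd M.card) (hM' : Odd M'.card)
    {A A' : Fin 4} (hA : A ∈ ({1, 2, 3} : Finset (Fin 4)))
    (hA' : A' ∈ ({1, 2, 3} : Finset (Fin 4))) :
    flipVec M A + flipVec M' A' = 0 ↔ M = M' ∧ A = A' := by
  have key := fun i => ite_flipBit_pair hA (decide (i ∈ M)) (decide (i ∈ M'))
  simp only [decide_eq_true_eq, decide_eq_decide] at key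
  constructor
  · intro h
    have hAA : A = A' := flipBit_pair hA hA' fun b => by
      rw [← sum_flipVec hM A b, ← sum_flipVec hM' A' b, ← Finset.sum_add_distrib]
      exact Finset.sum_eq_zero fun i _ => congrFun h (i, b)
    subst hAA
    exact ⟨Finset.ext fun i => (key i).1 fun b => congrFun h (i, b), rfl⟩
  · rintro ⟨rfl, rfl⟩
    ext1 p
    exact (key p.1).2 Iff.rfl p.2

theorem flipVec_add_add_eq_zero_iff {M M' M'' : Finset (Fin m)} (hM : Odd M.card)
    (hM' : Odd M'.card) (hM'' : Odd M''.card) {A A' A'' : Fin 4}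
    (hA : A ∈ ({1, 2, 3} : Finset (Fin 4))) (hA' : A' ∈ ({1, 2, 3} : Finset (Fin 4)))
    (hA'' : A'' ∈ ({1, 2, 3} : Finset (Fin 4))) :
    flipVec M A + flipVec M' A' + flipVec M'' A'' = 0 ↔
      (M = M' ∧ M' = M'') ∧ A ≠ A' ∧ A' ≠ A'' ∧ A ≠ A'' := by
  have key := fun hne i => ite_flipBit_triple hA hA' hA'' hne (decide (i ∈ M)) (decide (i ∈ M'))
    (decide (i ∈ M''))
  simp only [decide_eq_true_eq, decide_eq_decide] at key
  constructor
  · intro h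
    have hne := flipBit_triple hA hA' hA'' fun b => by
      rw [← sum_flipVec hM A b, ← sum_flipVec hM' A' b, ← sum_flipVec hM'' A'' b,
        ← Finset.sum_add_distrib, ← Finset.sum_add_distrib]
      exact Finset.sum_eq_zero fun i _ => congrFun h (i, b)
    have hmem := fun i => (key hne i).1 fun b => congrFun h (i, b)
    exact ⟨⟨Finset.ext fun i => (hmem i).1, Finset.ext fun i => (hmem i).2⟩, hne⟩
  · rintro ⟨⟨rfl, rfl⟩, hne⟩
    ext1 p
    exact (key hne p.1).2 ⟨Iff.rfl, Iff.rfl⟩ p.2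

/-- The excitation energy of a computational basis state of the auxiliary register. -/
def excitation (f : Fin m × Fin 2 → Fin 2) : ℝ :=
  2 * (Finset.univ.filter fun p => f p = 1).card

theorem excitation_flipVec (M : Finset (Fin m)) (A : Fin 4) :
    excitation (flipVec M A) =
      2 * (M.card * (Finset.univ.filter fun b => flipBit A b = 1).card) := by
  have : (Finset.univ.filter fun p => flipVec M A p = 1) =
      M ×ˢ (Finset.univ.filter fun b => flipBit A b = 1) := by
    ext p
    rw [Finset.mem_filter, Finset.mem_product, Finset.mem_filter]
    by_cases hp : p.1 ∈ M <;> simp [flipVec, hp]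
  rw [excitation, this, Finset.card_product]
  push_cast
  rfl

theorem excitation_eq_zero_or (f : Fin m × Fin 2 → Fin 2) :
    excitation f = 0 ∨ 2 ≤ excitation f := by
  rcases Nat.eq_zero_or_pos (Finset.univ.filter fun p => f p = 1).card with h | h
  · left; rw [excitation, h]; simp
  · right
    have : (1 : ℝ) ≤ (Finset.univ.filter fun p => f p = 1).card := by exact_mod_cast h
    rw [excitation]; linarith

theorem excitation_eq_zero_iff (f : Fin m × Fin 2 → Fin 2) : excitation f = 0 ↔ f = 0 := by
  have h01 : ∀ x : Fin 2, ¬ x = 1 ↔ x = 0 := by decide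
  simp [excitation, Finset.filter_eq_empty_iff, h01, funext_iff]

end FlipVectors

section Gadget

open Matrix

variable {n m r : ℕ} (ct c : Fin r → ℝ) (ptype : Fin r → Fin n → Fin 4)
  (Msets : Fin r → Finset (Fin m))

/-- The reduced resolvent of the unperturbed Hamiltonian on the auxiliary register, as a function
on computational basis states. -/
def resolventWeight (f : Fin m × Fin 2 → Fin 2) : ℂ := -(excitation f : ℂ)⁻¹

theorem Vpert_eq_sum : Vpert n m r ct ptype Msets =
    ∑ k ∈ Finset.univ ×ˢ ({1, 2, 3} : Finset (Fin 4)), (ct k.1 : ℂ) •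
      kron n m (Hpart n r ptype k.2 k.1) (flipOp (flipVec (Msets k.1) k.2)) := by
  rw [Finset.sum_product, Vpert]
  simp only [Vaux_eq_flipOp, Complex.coe_smul]

theorem Haux_eq_diagonal : Haux n m =
    diagonal (fun f => ((excitation (f ∘ Sum.inr) : ℝ) : ℂ)) - (2 * m : ℂ) • 1 := by
  have hact : ∀ p : Fin m × Fin 2, act (Sum.inr p : Idx n m) PZ =
      diagonal fun f => 1 - 2 * if f (Sum.inr p) = 1 then 1 else 0 := by
    intro p
    ext f g
    by_cases h : f = g
    · subst h
      have : ∀ x : Fin 2, PZ x x = 1 - 2 * if x = 1 then 1 else 0 := by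
        intro x
        fin_cases x <;> simp [PZ]
        norm_num
      simp [act, this]
    · rw [diagonal_apply_ne _ h, act]
      split_ifs with hj
      · have hne : f (Sum.inr p) ≠ g (Sum.inr p) := fun hp => h <| funext fun j => by
          by_cases hjp : j = Sum.inr p
          · rw [hjp, hp]
          · exact hj j hjp
        have : ∀ x y : Fin 2, x ≠ y → PZ x y = 0 := by
          intro x y
          fin_cases x <;> fin_cases y <;> simp [PZ]
        exact this _ _ hne
      · rfl
  rw [Haux, Finset.sum_congr rfl fun p _ => hact p]
  ext f g
  rw [Matrix.neg_apply, Matrix.sum_apply, Matrix.sub_apply, Matrix.smul_apply]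
  by_cases h : f = g
  · subst h
    simp only [diagonal_apply_eq, one_apply_eq, Finset.sum_sub_distrib, ← Finset.mul_sum,
      Finset.sum_boole, excitation, Function.comp_apply]
    simp
    ring
  · simp [diagonal_apply_ne _ h, one_apply_ne h]

variable {ct c ptype Msets}

theorem sum_univ_product_eq {α β M : Type*} [Fintype α] [DecidableEq α]
    [AddCommMonoid M] (t : Finset β) (a : α) (f : α × β → M)
    (h : ∀ a' ≠ a, ∀ b ∈ t, f (a', b) = 0) :
    ∑ k ∈ Finset.univ ×ˢ t, f k = ∑ b ∈ t, f (a, b) := by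
  rw [Finset.sum_product]
  exact Finset.sum_eq_single a (fun a' _ ha' => Finset.sum_eq_zero (h a' ha')) (by simp)

theorem second_order_sum (hM : Function.Injective Msets) (hodd : ∀ s, Odd (Msets s).card) :
    (∑ k ∈ Finset.univ ×ˢ ({1, 2, 3} : Finset (Fin 4)),
      ∑ k' ∈ Finset.univ ×ˢ ({1, 2, 3} : Finset (Fin 4)),
        (if flipVec (Msets k.1) k.2 + flipVec (Msets k'.1) k'.2 = 0 then
          (ct k.1 : ℂ) * ct k'.1 * resolventWeight (flipVec (Msets k.1) k.2) else 0) •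
          (Hpart n r ptype k.2 k.1 * Hpart n r ptype k'.2 k'.1)) =
      ((-∑ k ∈ Finset.univ ×ˢ ({1, 2, 3} : Finset (Fin 4)),
        ct k.1 ^ 2 / excitation (flipVec (Msets k.1) k.2) : ℝ) : ℂ) • 1 := by
  rw [← Finset.sum_neg_distrib, Complex.ofReal_sum, Finset.sum_smul]
  refine Finset.sum_congr rfl fun k hk => ?_
  have hk2 := (Finset.mem_product.1 hk).2
  rw [Finset.sum_eq_single_of_mem k hk]
  · rw [if_pos ((flipVec_add_eq_zero_iff (hodd _) (hodd _) hk2 hk2).2 ⟨rfl, rfl⟩),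
      Hpart_mul_self, resolventWeight]
    congr 1
    push_cast
    ring
  · intro k' hk' hne
    rw [if_neg, zero_smul]
    rw [flipVec_add_eq_zero_iff (hodd _) (hodd _) hk2 (Finset.mem_product.1 hk').2]
    exact fun h => hne (Prod.ext (hM h.1.symm) h.2.symm)

theorem third_order_sum (hM : Function.Injective Msets) (hodd : ∀ s, Odd (Msets s).card)
    (hct : ∀ s, ct s ^ 3 = c s * ((Msets s).card : ℝ) ^ 2) :
    (∑ k ∈ Finset.univ ×ˢ ({1, 2, 3} : Finset (Fin 4)),
      ∑ k' ∈ Finset.univ ×ˢ ({1, 2, 3} : Finset (Fin 4)),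
        ∑ k'' ∈ Finset.univ ×ˢ ({1, 2, 3} : Finset (Fin 4)),
          (if flipVec (Msets k.1) k.2 + flipVec (Msets k'.1) k'.2 +
              flipVec (Msets k''.1) k''.2 = 0 then
            (ct k.1 : ℂ) * ct k'.1 * ct k''.1 * resolventWeight (flipVec (Msets k.1) k.2) *
              resolventWeight (flipVec (Msets k''.1) k''.2) else 0) •
          (Hpart n r ptype k.2 k.1 * Hpart n r ptype k'.2 k'.1 * Hpart n r ptype k''.2 k''.1)) =
      Htarget n r c ptype := by
  rw [Finset.sum_product, Htarget]
  refine Finset.sum_congr rfl fun s _ => ?_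
  have hcollapse : ∀ A ∈ ({1, 2, 3} : Finset (Fin 4)),
      (∑ k' ∈ Finset.univ ×ˢ ({1, 2, 3} : Finset (Fin 4)),
        ∑ k'' ∈ Finset.univ ×ˢ ({1, 2, 3} : Finset (Fin 4)),
          (if flipVec (Msets s) A + flipVec (Msets k'.1) k'.2 +
              flipVec (Msets k''.1) k''.2 = 0 then
            (ct s : ℂ) * ct k'.1 * ct k''.1 * resolventWeight (flipVec (Msets s) A) *
              resolventWeight (flipVec (Msets k''.1) k''.2) else 0) •
          (Hpart n r ptype A s * Hpart n r ptype k'.2 k'.1 * Hpart n r ptype k''.2 k''.1)) =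
      ∑ A' ∈ ({1, 2, 3} : Finset (Fin 4)), ∑ A'' ∈ ({1, 2, 3} : Finset (Fin 4)),
        (if A ≠ A' ∧ A' ≠ A'' ∧ A ≠ A'' then
            (ct s : ℂ) ^ 3 * resolventWeight (flipVec (Msets s) A) *
              resolventWeight (flipVec (Msets s) A'') else 0) •
          (Hpart n r ptype A s * Hpart n r ptype A' s * Hpart n r ptype A'' s) := by
    intro A hA
    rw [sum_univ_product_eq _ s]
    · refine Finset.sum_congr rfl fun A' hA' => ?_
      rw [sum_univ_product_eq _ s]
      · refine Finset.sum_congr rfl fun A'' hA'' => ?_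
        simp only [flipVec_add_add_eq_zero_iff (hodd _) (hodd _) (hodd _) hA hA' hA'', true_and]
        congr 2
        ring
      · intro s'' hs'' A'' hA''
        rw [if_neg, zero_smul]
        rw [flipVec_add_add_eq_zero_iff (hodd _) (hodd _) (hodd _) hA hA' hA'']
        exact fun h => hs'' (hM h.1.2).symm
    · intro s' hs' A' hA'
      refine Finset.sum_eq_zero fun k'' hk'' => ?_
      rw [if_neg, zero_smul]
      rw [flipVec_add_add_eq_zero_iff (hodd _) (hodd _) (hodd _) hA hA'
        (Finset.mem_product.1 hk'').2]
      exact fun h => hs' (hM h.1.1).symm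
  rw [Finset.sum_congr rfl hcollapse]
  have hM0 : ((Msets s).card : ℂ) ≠ 0 := by exact_mod_cast (hodd s).pos.ne'
  have hcs : (ct s : ℂ) ^ 3 = c s * ((Msets s).card : ℂ) ^ 2 := by exact_mod_cast hct s
  have hw : ∀ A : Fin 4, resolventWeight (flipVec (Msets s) A) =
      -(2 * ((Msets s).card * ((Finset.univ.filter fun b => flipBit A b = 1).card : ℂ)))⁻¹ := by
    intro A
    rw [resolventWeight, excitation_flipVec]
    push_cast
    rfl
  have n1 : (Finset.univ.filter fun b => flipBit 1 b = 1).card = 1 := by decide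
  have n2 : (Finset.univ.filter fun b => flipBit 2 b = 1).card = 1 := by decide
  have n3 : (Finset.univ.filter fun b => flipBit 3 b = 1).card = 2 := by decide
  have hsum : ∀ f : Fin 4 → Matrix (Fin n → Fin 2) (Fin n → Fin 2) ℂ,
      ∑ A ∈ ({1, 2, 3} : Finset (Fin 4)), f A = f 1 + f 2 + f 3 := by
    intro f
    rw [Finset.sum_insert (by decide), Finset.sum_insert (by decide), Finset.sum_singleton,
      add_assoc]
  simp only [hsum, hw, n1, n2, n3, hcs]
  have e21 := Hpart_comm ptype 2 1 s
  have e31 := Hpart_comm ptype 3 1 s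
  have e32 := Hpart_comm ptype 3 2 s
  have p132 : Hpart n r ptype 1 s * Hpart n r ptype 3 s * Hpart n r ptype 2 s =
      Hstring n r ptype s := by rw [Hstring, Matrix.mul_assoc, e32, Matrix.mul_assoc]
  have p213 : Hpart n r ptype 2 s * Hpart n r ptype 1 s * Hpart n r ptype 3 s =
      Hstring n r ptype s := by rw [Hstring, e21]
  have p312 : Hpart n r ptype 3 s * Hpart n r ptype 1 s * Hpart n r ptype 2 s =
      Hstring n r ptype s := by rw [e31, p132]
  have p231 : Hpart n r ptype 2 s * Hpart n r ptype 3 s * Hpart n r ptype 1 s =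
      Hstring n r ptype s := by rw [Matrix.mul_assoc, e31, ← Matrix.mul_assoc, p213]
  have p321 : Hpart n r ptype 3 s * Hpart n r ptype 2 s * Hpart n r ptype 1 s =
      Hstring n r ptype s := by rw [e32, p231]
  have p123 : Hpart n r ptype 1 s * Hpart n r ptype 2 s * Hpart n r ptype 3 s =
      Hstring n r ptype s := rfl
  have d12 : (1 : Fin 4) ≠ 2 := by decide
  have d13 : (1 : Fin 4) ≠ 3 := by decide
  have d23 : (2 : Fin 4) ≠ 3 := by decide
  simp only [ne_eq, not_true_eq_false, false_and, and_false, if_false, zero_smul, d12, d13, d23,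
    d12.symm, d13.symm, d23.symm, not_false_eq_true, and_self, if_true, p123, p132, p213, p231,
    p312, p321, zero_add, add_zero, ← add_smul]
  rw [← Complex.coe_smul]
  congr 1
  push_cast
  field_simp
  ring

end Gadget

section EffectiveHamiltonian

open Matrix

open scoped Matrix.Norms.L2Operator

theorem card_excitation_eq_zero (n m : ℕ) :
    (Finset.univ.filter fun f : Idx n m → Fin 2 => excitation (f ∘ Sum.inr) = 0).card = 2 ^ n := by
  have himg : (Finset.univ.filter fun f : Idx n m → Fin 2 => excitation (f ∘ Sum.inr) = 0) =
      Finset.univ.image fun g : Fin n → Fin 2 => (Sum.elim g 0 : Idx n m → Fin 2) := by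
    ext f
    simp only [Finset.mem_filter, Finset.mem_univ, true_and, Finset.mem_image,
      excitation_eq_zero_iff]
    constructor
    · intro h
      exact ⟨f ∘ Sum.inl, by rw [← h, Sum.elim_comp_inl_inr]⟩
    · rintro ⟨g, rfl⟩
      exact Sum.elim_comp_inr _ _
  rw [himg, Finset.card_image_of_injective _ fun g g' h => ?_]
  · simp
  · exact (Sum.elim_comp_inl g 0).symm.trans
      ((congrArg (· ∘ Sum.inl) h).trans (Sum.elim_comp_inl g' 0))

omit [Fintype ι] [DecidableEq ι] in
theorem eigenSum_eq_sum_outer {J : Type*} [Fintype J] [DecidableEq J] (U : Matrix (ι → Fin 2) J ℂ)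
    (b : J → ℝ) : eigenSum U b = ∑ i, b i • outer fun x => U x i := by
  ext x y
  rw [eigenSum, mul_apply, Matrix.sum_apply]
  refine Finset.sum_congr rfl fun i _ => ?_
  rw [mul_diagonal, conjTranspose_apply, Matrix.smul_apply, outer, vecMulVec_apply, Pi.star_apply,
    Complex.real_smul]
  ring

end EffectiveHamiltonian

theorem measurement_gadget_effective_hamiltonian
    (n m r : ℕ) (hm : 1 ≤ m)
    (c : Fin r → ℝ) (ptype : Fin r → Fin n → Fin 4)
    (hnonid : ∀ s, ∃ i, ptype s i ≠ 0)
    (Msets : Fin r → Finset (Fin m))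
    (hMdistinct : Function.Injective Msets)
    (hModd : ∀ s, Odd (Msets s).card)
    (ct : Fin r → ℝ)
    (hct : ∀ s, ct s ^ 3 = c s * ((Msets s).card : ℝ) ^ 2) :
    ∃ C : ℝ, 0 < C ∧
      ∀ lam : ℝ, 0 < lam → lam < 1 / (2 * opNorm (Vpert n m r ct ptype Msets)) →
        ∃ Δ : ℝ,
          -- for every orthonormal eigenbasis of `H^gad` with nondecreasing eigenvalues
          ∀ (E : Fin (2 ^ (n + 2 * m)) → ℝ)
            (ψ : Fin (2 ^ (n + 2 * m)) → (Idx n m → Fin 2) → ℂ),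
            Monotone E →
            (∀ i j, (∑ x, (starRingEnd ℂ) (ψ i x) * ψ j x) = if i = j then 1 else 0) →
            (∀ i, Hgad n m r ct ptype Msets lam *ᵥ ψ i = (E i : ℂ) • ψ i) →
            opNorm
              ((∑ i ∈ Finset.univ.filter (fun i : Fin (2 ^ (n + 2 * m)) => (i : ℕ) < 2 ^ n),
                  E i • outer (ψ i))
                - Δ • (∑ i ∈ Finset.univ.filter
                    (fun i : Fin (2 ^ (n + 2 * m)) => (i : ℕ) < 2 ^ n), outer (ψ i))
                - lam ^ 3 • kron n m (Htarget n r c ptype) (Pplus m))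
              ≤ C * lam ^ 4 := by
  classical
  set P := kron n m 1 (Pplus m)
  set R := kron n m 1 (Matrix.diagonal resolventWeight)
  set V := Vpert n m r ct ptype Msets
  set μ : ℝ := -∑ k ∈ Finset.univ ×ˢ ({1, 2, 3} : Finset (Fin 4)),
    ct k.1 ^ 2 / excitation (flipVec (Msets k.1) k.2)
  have hP : P = Matrix.diagonal fun f : Idx n m → Fin 2 =>
      if excitation (f ∘ Sum.inr) = 0 then 1 else 0 := by
    simp only [P, Pplus_eq_diagonal, kron_one_diagonal, excitation_eq_zero_iff]
  have h₁ : P * V * P = 0 := by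
    simp only [P, V, Vpert_eq_sum, first_order_expansion]
    rw [Finset.sum_eq_zero, ← zero_smul ℂ (0 : Matrix _ _ ℂ), kron_smul_left, zero_smul]
    intro k hk
    rw [if_neg (flipVec_ne_zero (hModd _) (Finset.mem_product.1 hk).2), zero_smul]
  have h₂ : P * V * R * V * P = (μ : ℂ) • P := by
    simp only [P, R, V, Vpert_eq_sum, second_order_expansion]
    rw [second_order_sum hMdistinct hModd, kron_smul_left]
  have h₃ : P * V * R * V * R * V * P = kron n m (Htarget n r c ptype) (Pplus m) := by
    simp only [P, R, V, Vpert_eq_sum, third_order_expansion]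
    rw [third_order_sum hMdistinct hModd hct]
  obtain ⟨C, hC, hbound⟩ := exists_effective_hamiltonian_bound (N := 2 ^ (n + 2 * m)) (μ := μ)
    (fun f : Idx n m → Fin 2 => excitation_eq_zero_or (f ∘ Sum.inr))
    (by simp [mul_comm]) (card_excitation_eq_zero n m) hP (kron_one_diagonal n m _) h₁ h₂ h₃
  refine ⟨C, hC, fun lam hlam _ => ⟨lam ^ 2 * μ - 2 * m, fun E ψ hmono hortho heig => ?_⟩⟩
  set U : Matrix (Idx n m → Fin 2) (Fin (2 ^ (n + 2 * m))) ℂ := fun x i => ψ i x with hUdef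
  have hU : U.conjTranspose * U = 1 := by
    ext i j
    rw [Matrix.mul_apply, Matrix.one_apply, ← hortho i j]
    rfl
  have hHU : (Matrix.diagonal (fun f : Idx n m → Fin 2 => (excitation (f ∘ Sum.inr) : ℂ)) +
      (lam : ℂ) • V) * U = U * Matrix.diagonal (fun i => ((E i + 2 * m : ℝ) : ℂ)) := by
    have hH : Matrix.diagonal (fun f : Idx n m → Fin 2 => (excitation (f ∘ Sum.inr) : ℂ)) +
        (lam : ℂ) • V = Hgad n m r ct ptype Msets lam + (2 * m : ℂ) • 1 := by
      rw [Hgad, Haux_eq_diagonal, Complex.coe_smul]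
      abel
    rw [hH, Matrix.add_mul, Matrix.smul_mul, Matrix.one_mul]
    ext x i
    have := congrFun (heig i) x
    rw [Pi.smul_apply, smul_eq_mul] at this
    rw [Matrix.add_apply, Matrix.smul_apply, Matrix.mul_diagonal, Matrix.mul_apply_eq_vecMul]
    refine (congrArg (· + _) this).trans ?_
    simp only [hUdef, smul_eq_mul]
    push_cast
    ring
  have hfin := hbound lam hlam (fun i => E i + 2 * m) U (fun i j hij => by
    simpa using hmono hij) hU hHU
  have hsum : eigenSum U (fun i => if (i : ℕ) < 2 ^ n then E i + 2 * m - lam ^ 2 * μ else 0) =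
      (∑ i ∈ Finset.univ.filter (fun i : Fin (2 ^ (n + 2 * m)) => (i : ℕ) < 2 ^ n),
          E i • outer (ψ i)) - (lam ^ 2 * μ - 2 * m) • (∑ i ∈ Finset.univ.filter
            (fun i : Fin (2 ^ (n + 2 * m)) => (i : ℕ) < 2 ^ n), outer (ψ i)) := by
    rw [eigenSum_eq_sum_outer, Finset.smul_sum, ← Finset.sum_sub_distrib, Finset.sum_filter]
    refine Finset.sum_congr rfl fun i _ => ?_
    split_ifs
    · rw [← sub_smul]
      congr 1
      ring
    · rw [zero_smul]
  rwa [hsum, Matrix.cstar_norm_def, ← Complex.ofReal_pow, Complex.coe_smul] at hfin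

end Stmt2
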